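/- Let X, U, W be finite nonempty sets, h ≥ 1 a horizon, f : X × U × W → X the dynamics, g : X × U → ℝ the stage cost, g_h : X → ℝ the terminal cost, and for each k ∈ {0,…,h−1} let r_k : X × U → (W → ℝ) be such that r_k(x,u) is a probability vector with r_k(x,u)(w) > 0 for all w. Let γ_H ≥ 0 and γ_E > 0. Define J_h = g_h and, backwards for k = h−1,…,0, J_k(x) = min over u ∈ U of [ g(x,u) + γ_E·log ∑_w exp( (γ_H·log r_k(x,u)(w) + J_{k+1}(f(x,u,w))) / γ_E ) ]. For a control policy μ = (μ_0,…,μ_{h−1}) with μ_k : X → U and an adversarial policy p = (p_0,…,p_{h−1}) with p_k(x,u) a probability vector on W, define the regularized expected cost V_k^{μ,p}(x) recursively by V_h^{μ,p}(x) = g_h(x) and V_k^{μ,p}(x) = g(x,μ_k(x)) − γ_H·H_c(p_k(x,μ_k(x)), r_k(x,μ_k(x))) + γ_E·H(p_k(x,μ_k(x))) + ∑_w p_k(x,μ_k(x))(w)·V_{k+1}^{μ,p}(f(x,μ_k(x),w)). Then for every x_0 ∈ X, min over μ of max over p of V_0^{μ,p}(x_0) = J_0(x_0). -/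

import Mathlib

open Real

/-- The Gibbs variational inequality on a finite set: entropy-regularized expectation is bounded by
the log-sum-exp function. -/
theorem sum_mul_add_entropy_le_log_sum_exp {W : Type*} [Fintype W] [Nonempty W]
    (c : ℝ) (hc : 0 < c) (a p : W → ℝ) (hp0 : ∀ w, 0 ≤ p w) (hp1 : ∑ w, p w = 1) :
    ∑ w, p w * a w + c * (-∑ w, p w * Real.log (p w)) ≤
      c * Real.log (∑ w, Real.exp (a w / c)) := by
  set Z := ∑ w, Real.exp (a w / c) with hZ
  have hZpos : 0 < Z := Finset.sum_pos (fun w _ => Real.exp_pos _) Finset.univ_nonempty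
  have key : ∀ w, p w * (a w / c) - p w * Real.log (p w) - p w * Real.log Z ≤
      Real.exp (a w / c) / Z - p w := by
    intro w
    rcases (hp0 w).eq_or_lt with h | h
    · rw [← h]
      have : 0 ≤ Real.exp (a w / c) / Z := by positivity
      simpa using this
    · have h1 := Real.log_le_sub_one_of_pos
        (show 0 < Real.exp (a w / c) / (Z * p w) by positivity)
      rw [Real.log_div (Real.exp_pos _).ne' (by positivity), Real.log_exp,
        Real.log_mul hZpos.ne' h.ne'] at h1
      have h2 := mul_le_mul_of_nonneg_left h1 h.le
      have h3 : p w * (Real.exp (a w / c) / (Z * p w) - 1) = Real.exp (a w / c) / Z - p w := by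
        field_simp
      linarith
  have hsum := Finset.sum_le_sum (fun w (_ : w ∈ Finset.univ) => key w)
  simp only [Finset.sum_sub_distrib, ← Finset.sum_mul, ← Finset.sum_div, hp1, ← hZ,
    div_self hZpos.ne', one_mul] at hsum
  have h4 : ∑ w, p w * a w = c * ∑ w, p w * (a w / c) := by
    rw [Finset.mul_sum]
    refine Finset.sum_congr rfl fun w _ => ?_
    field_simp
  rw [h4]
  nlinarith

/-- The softmax (Gibbs) distribution at temperature `c`. -/
noncomputable def gibbsWeight {W : Type*} [Fintype W] (c : ℝ) (a : W → ℝ) (w : W) : ℝ :=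
  Real.exp (a w / c) / ∑ w', Real.exp (a w' / c)

theorem gibbsWeight_nonneg {W : Type*} [Fintype W] (c : ℝ) (a : W → ℝ) (w : W) :
    0 ≤ gibbsWeight c a w := by
  unfold gibbsWeight
  positivity

theorem sum_gibbsWeight {W : Type*} [Fintype W] [Nonempty W] (c : ℝ) (a : W → ℝ) :
    ∑ w, gibbsWeight c a w = 1 := by
  simp only [gibbsWeight]
  rw [← Finset.sum_div, div_self]
  exact (Finset.sum_pos (fun w _ => Real.exp_pos _) Finset.univ_nonempty).ne'

/-- The Gibbs distribution attains equality in the Gibbs variational inequality. -/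
theorem gibbsWeight_attains {W : Type*} [Fintype W] [Nonempty W]
    (c : ℝ) (hc : 0 < c) (a : W → ℝ) :
    ∑ w, gibbsWeight c a w * a w +
        c * (-∑ w, gibbsWeight c a w * Real.log (gibbsWeight c a w)) =
      c * Real.log (∑ w, Real.exp (a w / c)) := by
  have hZpos : 0 < ∑ w, Real.exp (a w / c) :=
    Finset.sum_pos (fun w _ => Real.exp_pos _) Finset.univ_nonempty
  have hlog : ∀ w, Real.log (gibbsWeight c a w) =
      a w / c - Real.log (∑ w', Real.exp (a w' / c)) := by
    intro w
    rw [gibbsWeight, Real.log_div (Real.exp_pos _).ne' hZpos.ne', Real.log_exp]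
  simp only [hlog, mul_sub, Finset.sum_sub_distrib, ← Finset.sum_mul, sum_gibbsWeight]
  have h4 : ∑ w, gibbsWeight c a w * a w = c * ∑ w, gibbsWeight c a w * (a w / c) := by
    rw [Finset.mul_sum]
    refine Finset.sum_congr rfl fun w _ => ?_
    field_simp
  rw [h4]
  ring

theorem minsoftmax_dynamic_programming
    {X U W : Type*} [Fintype X] [Nonempty X] [Fintype U] [Nonempty U]
    [Fintype W] [Nonempty W]
    (h : ℕ) (hh : 1 ≤ h)
    (f : X → U → W → X) (g : X → U → ℝ) (gh : X → ℝ)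
    (r : ℕ → X → U → W → ℝ)
    (hr0 : ∀ k, k < h → ∀ x u w, 0 < r k x u w)
    (hr1 : ∀ k, k < h → ∀ x u, ∑ w, r k x u w = 1)
    (γH γE : ℝ) (hγH : 0 ≤ γH) (hγE : 0 < γE)
    -- the minsoftmax value functions J_k
    (J : ℕ → X → ℝ)
    (hJh : ∀ x, J h x = gh x)
    (hJ : ∀ k, k < h → ∀ x, J k x =
      ⨅ u : U, (g x u + γE * Real.log (∑ w,
        Real.exp ((γH * Real.log (r k x u w) + J (k + 1) (f x u w)) / γE))))
    -- the regularized expected cost V_k^{μ,p}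
    (V : (ℕ → X → U) → (ℕ → X → U → W → ℝ) → ℕ → X → ℝ)
    (hVh : ∀ μ p x, V μ p h x = gh x)
    (hV : ∀ μ p, ∀ k, k < h → ∀ x, V μ p k x =
      g x (μ k x)
        - γH * (-∑ w, p k x (μ k x) w * Real.log (r k x (μ k x) w))
        + γE * (-∑ w, p k x (μ k x) w * Real.log (p k x (μ k x) w))
        + ∑ w, p k x (μ k x) w * V μ p (k + 1) (f x (μ k x) w)) :
    ∀ x0 : X,
      (⨅ μ : ℕ → X → U, sSup {v : ℝ | ∃ p : ℕ → X → U → W → ℝ,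
          (∀ k, k < h → ∀ x u, (∀ w, 0 ≤ p k x u w) ∧ ∑ w, p k x u w = 1) ∧
          v = V μ p 0 x0})
        = J 0 x0 := by
  have stage : ∀ (q ρ v : W → ℝ) (y : ℝ),
      y - γH * (-∑ w, q w * Real.log (ρ w)) + γE * (-∑ w, q w * Real.log (q w))
        + ∑ w, q w * v w =
      y + (∑ w, q w * (γH * Real.log (ρ w) + v w)
        + γE * (-∑ w, q w * Real.log (q w))) := by
    intro q ρ v y
    have : ∑ w, q w * (γH * Real.log (ρ w) + v w) =
        γH * ∑ w, q w * Real.log (ρ w) + ∑ w, q w * v w := by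
      rw [Finset.mul_sum, ← Finset.sum_add_distrib]
      exact Finset.sum_congr rfl fun w _ => by ring
    rw [this]
    ring
  let Q : ℕ → (X → ℝ) → X → U → ℝ := fun k F x u =>
    g x u + γE * Real.log (∑ w, Real.exp ((γH * Real.log (r k x u w) + F (f x u w)) / γE))
  let adm : (ℕ → X → U → W → ℝ) → Prop := fun p =>
    ∀ k, k < h → ∀ x u, (∀ w, 0 ≤ p k x u w) ∧ ∑ w, p k x u w = 1
  have step_le : ∀ μ p, adm p → ∀ k, k < h → ∀ F : X → ℝ,
      (∀ x, V μ p (k + 1) x ≤ F x) → ∀ x, V μ p k x ≤ Q k F x (μ k x) := by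
    intro μ p hp k hk F hF x
    obtain ⟨hp0, hp1⟩ := hp k hk x (μ k x)
    rw [hV μ p k hk x, stage (p k x (μ k x)) (r k x (μ k x))
      (fun w => V μ p (k + 1) (f x (μ k x) w))]
    refine add_le_add le_rfl (le_trans (add_le_add (Finset.sum_le_sum fun w _ => ?_) le_rfl)
      (sum_mul_add_entropy_le_log_sum_exp γE hγE
        (fun w => γH * Real.log (r k x (μ k x) w) + F (f x (μ k x) w)) _ hp0 hp1))
    exact mul_le_mul_of_nonneg_left (add_le_add le_rfl (hF _)) (hp0 w)
  have bounded : ∀ μ, ∀ k, k ≤ h → ∃ F : X → ℝ, ∀ p, adm p → ∀ x, V μ p k x ≤ F x := by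
    intro μ k hk
    induction hk using Nat.decreasingInduction with
    | self => exact ⟨gh, fun p _ x => (hVh μ p x).le⟩
    | of_succ k hk ih =>
      obtain ⟨F, hF⟩ := ih
      exact ⟨fun x => Q k F x (μ k x), fun p hp => step_le μ p hp k hk F (hF p hp)⟩
  let pS : ℕ → X → U → W → ℝ := fun k x u =>
    gibbsWeight γE fun w => γH * Real.log (r k x u w) + J (k + 1) (f x u w)
  have pS_adm : adm pS := fun k _ x u =>
    ⟨fun w => gibbsWeight_nonneg _ _ w, sum_gibbsWeight _ _⟩
  have lower : ∀ μ, ∀ k, k ≤ h → ∀ x, J k x ≤ V μ pS k x := by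
    intro μ k hk
    induction hk using Nat.decreasingInduction with
    | self => exact fun x => by rw [hJh, hVh]
    | of_succ k hk ih =>
      intro x
      rw [hV μ pS k hk x, stage (pS k x (μ k x)) (r k x (μ k x))
        (fun w => V μ pS (k + 1) (f x (μ k x) w)), hJ k hk x]
      refine (ciInf_le (Set.finite_range _).bddBelow (μ k x)).trans
        (add_le_add le_rfl ?_)
      rw [← gibbsWeight_attains γE hγE
        (fun w => γH * Real.log (r k x (μ k x) w) + J (k + 1) (f x (μ k x) w))]
      refine add_le_add (Finset.sum_le_sum fun w _ => ?_) le_rfl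
      exact mul_le_mul_of_nonneg_left (add_le_add le_rfl (ih _)) (gibbsWeight_nonneg _ _ w)
  have argmin : ∀ k x, ∃ u, Q k (J (k + 1)) x u = ⨅ u, Q k (J (k + 1)) x u :=
    fun k x => exists_eq_ciInf_of_finite
  choose μS hμS using argmin
  have upper : ∀ p, adm p → ∀ k, k ≤ h → ∀ x, V μS p k x ≤ J k x := by
    intro p hp k hk
    induction hk using Nat.decreasingInduction with
    | self => exact fun x => by rw [hJh, hVh]
    | of_succ k hk ih =>
      intro x
      rw [hJ k hk x]
      exact (step_le μS p hp k hk _ ih x).trans (hμS k x).le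
  intro x0
  have le_sup : ∀ μ, J 0 x0 ≤ sSup {v : ℝ | ∃ p, adm p ∧ v = V μ p 0 x0} := by
    intro μ
    obtain ⟨F, hF⟩ := bounded μ 0 h.zero_le
    refine (lower μ 0 h.zero_le x0).trans (le_csSup ⟨F x0, ?_⟩ ⟨pS, pS_adm, rfl⟩)
    rintro _ ⟨p, hp, rfl⟩
    exact hF p hp x0
  refine le_antisymm ((ciInf_le ⟨J 0 x0, ?_⟩ μS).trans (csSup_le ⟨_, pS, pS_adm, rfl⟩ ?_))
    (le_ciInf le_sup)
  · rintro _ ⟨μ, rfl⟩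
    exact le_sup μ
  · rintro _ ⟨p, hp, rfl⟩
    exact upper p hp 0 h.zero_le x0
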